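/- Assume the modulus of contraction γ of δ is itself a variable discount function and Ψ(x) = Ψ(y) for all x, y ∈ X. Let V̂* be the unique bounded continuous fixed point of the joint Bellman operator B̂(V)(x,y) = sup_{a ∈ Ψ̂(x,y)} [û(x,y,a) + γ(V(f̂(x,y,a)))]. Then: (a) V̂*(x,y) ≥ 0 for all x, y and V̂*(x,x) = 0 for all x; (b) V̂*(x,y) = V̂*(y,x) for all x, y. That is, V̂* : X² → ℝ is a symmetric nonnegative function vanishing on the diagonal. -/

import Mathlib

open Filter Topology

theorem aux_lt {φ : ℝ → ℝ} (hm : MonotoneOn φ (Set.Ici 0)) (hnn : ∀ t, 0 ≤ t → 0 ≤ φ t)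
    (hit : ∀ t, 0 ≤ t → Tendsto (fun n => φ^[n] t) atTop (𝓝 0)) (t : ℝ) (ht : 0 < t) :
    φ t < t := by
  by_contra! h
  have key : ∀ n, t ≤ φ^[n] t := by
    intro n
    induction n with
    | zero => simp
    | succ n ih =>
      rw [Function.iterate_succ_apply']
      exact h.trans (hm ht.le (ht.le.trans ih) ih)
  exact absurd (ge_of_tendsto' (hit t ht.le) key) (not_le.2 ht)

theorem aux_fix {E : Type*} [MetricSpace E] [CompleteSpace E] [Nonempty E] (T : E → E)
    {φ : ℝ → ℝ} (hm : MonotoneOn φ (Set.Ici 0)) (hnn : ∀ t, 0 ≤ t → 0 ≤ φ t)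
    (hit : ∀ t, 0 ≤ t → Tendsto (fun n => φ^[n] t) atTop (𝓝 0))
    (hT : ∀ x y, dist (T x) (T y) ≤ φ (dist x y)) : ∃ x, T x = x := by
  have hlt := aux_lt hm hnn hit
  have hle : ∀ x y, dist (T x) (T y) ≤ dist x y := by
    intro x y
    by_cases hxy : x = y
    · subst hxy; simp
    · exact (hT x y).trans (hlt _ (dist_pos.2 hxy)).le
  obtain ⟨x0⟩ := ‹Nonempty E›
  set s : ℕ → E := fun n => T^[n] x0 with hs
  have hs1 : ∀ n, s (n+1) = T (s n) := fun n => Function.iterate_succ_apply' T n x0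
  have hd : ∀ n, dist (s (n+1)) (s n) ≤ φ^[n] (dist (s 1) (s 0)) := by
    intro n
    induction n with
    | zero => simp
    | succ n ih =>
      rw [Function.iterate_succ_apply']
      have h0 : dist (s (n+1+1)) (s (n+1)) = dist (T (s (n+1))) (T (s n)) := by
        rw [← hs1, ← hs1]
      rw [h0]
      exact (hT _ _).trans (hm dist_nonneg (dist_nonneg.trans ih) ih)
  have hd0 : Tendsto (fun n => dist (s (n+1)) (s n)) atTop (𝓝 0) :=
    squeeze_zero (fun _ => dist_nonneg) hd (hit _ dist_nonneg)
  have hc : CauchySeq s := by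
    rw [Metric.cauchySeq_iff']
    intro e he
    have he2 : 0 < e / 2 := by linarith
    have hgap : 0 < e/2 - φ (e/2) := sub_pos.2 (hlt _ he2)
    obtain ⟨N, hN⟩ := (hd0.eventually (gt_mem_nhds hgap)).exists
    refine ⟨N, fun n hn => ?_⟩
    suffices h : dist (s n) (s N) ≤ e/2 by linarith
    induction n, hn using Nat.le_induction with
    | base => simpa using he2.le
    | succ n hn ih =>
      have h1 := dist_triangle (s (n+1)) (s (N+1)) (s N)
      have h2 : dist (s (n+1)) (s (N+1)) ≤ φ (e/2) := by
        rw [hs1, hs1]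
        exact (hT _ _).trans (hm dist_nonneg he2.le ih)
      linarith
  obtain ⟨x, hx⟩ := cauchySeq_tendsto_of_complete hc
  have hTc : Continuous T := (LipschitzWith.of_dist_le_mul (K := 1) (by simpa using hle)).continuous
  refine ⟨x, tendsto_nhds_unique ((hTc.tendsto x).comp hx) ?_⟩
  have := hx.comp (tendsto_add_atTop_nat 1)
  refine this.congr fun n => ?_
  simp [hs1]

theorem aux_sup {A : Type*} {K : Set A} (hne : K.Nonempty) {F G : A → ℝ} {c : ℝ}
    (hG : BddAbove (G '' K)) (h : ∀ a ∈ K, F a ≤ G a + c) :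
    sSup (F '' K) ≤ sSup (G '' K) + c := by
  apply csSup_le (hne.image F)
  rintro _ ⟨a, ha, rfl⟩
  have := le_csSup hG ⟨a, ha, rfl⟩
  linarith [h a ha]

theorem aux_exists {X A : Type*} [MetricSpace X] [MetricSpace A]
    (K : Set A) (f : X × A → X) (u : X × A → ℝ) (γ γ' : ℝ → ℝ)
    (hK : IsCompact K) (hne : K.Nonempty)
    (hf : Continuous f) (hu : Continuous u)
    (hunn : ∀ p, 0 ≤ u p) (hub : ∃ C, ∀ p, u p ≤ C)
    (hγmono : MonotoneOn γ (Set.Ici 0)) (hγnn : ∀ t, 0 ≤ t → 0 ≤ γ t)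
    (hγcont : ContinuousOn γ (Set.Ici 0))
    (hm : MonotoneOn γ' (Set.Ici 0)) (hnn : ∀ t, 0 ≤ t → 0 ≤ γ' t)
    (hit : ∀ t, 0 ≤ t → Tendsto (fun n => γ'^[n] t) atTop (𝓝 0))
    (hγ'γ : ∀ s t, 0 ≤ s → 0 ≤ t → |γ s - γ t| ≤ γ' |s - t|) :
    ∃ V : X × X → ℝ, Continuous V ∧ (∃ C, ∀ p, |V p| ≤ C) ∧ (∀ p, 0 ≤ V p) ∧
      ∀ x y, V (x, y) =
        sSup ((fun a => |u (x, a) - u (y, a)| + γ (V (f (x, a), f (y, a)))) '' K) := by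
  obtain ⟨C, hC⟩ := hub
  have hg : Continuous (fun t : ℝ => γ (max t 0)) :=
    hγcont.comp_continuous (by fun_prop) (fun t => Set.mem_Ici.2 (le_max_right _ _))
  let F : BoundedContinuousFunction (X × X) ℝ → X × X → A → ℝ := fun V p a =>
    |u (p.1, a) - u (p.2, a)| + γ (max (V (f (p.1, a), f (p.2, a))) 0)
  have hF0 : ∀ V p a, 0 ≤ F V p a := fun V p a =>
    add_nonneg (abs_nonneg _) (hγnn _ (le_max_right _ _))
  have hFb : ∀ V p a, F V p a ≤ C + γ ‖V‖ := by
    intro V p a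
    refine add_le_add ?_ (hγmono (Set.mem_Ici.2 (le_max_right _ _)) (Set.mem_Ici.2 (norm_nonneg V)) ?_)
    · rw [abs_le]
      constructor <;> linarith [hunn (p.1, a), hunn (p.2, a), hC (p.1, a), hC (p.2, a)]
    · exact max_le ((le_abs_self _).trans (V.norm_coe_le_norm _)) (norm_nonneg V)
  have hbdd : ∀ V p, BddAbove (F V p '' K) := by
    intro V p
    refine ⟨C + γ ‖V‖, ?_⟩
    rintro _ ⟨a, _, rfl⟩
    exact hFb V p a
  have hS0 : ∀ V p, 0 ≤ sSup (F V p '' K) := by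
    intro V p
    apply Real.sSup_nonneg
    rintro _ ⟨a, _, rfl⟩
    exact hF0 V p a
  have hSb : ∀ V p, ‖sSup (F V p '' K)‖ ≤ C + γ ‖V‖ := by
    intro V p
    rw [Real.norm_of_nonneg (hS0 V p)]
    apply csSup_le (hne.image _)
    rintro _ ⟨a, _, rfl⟩
    exact hFb V p a
  have hcont : ∀ V, Continuous (fun p => sSup (F V p '' K)) := by
    intro V
    apply hK.continuous_sSup
    have h1 : Continuous (fun q : (X × X) × A => V (f (q.1.1, q.2), f (q.1.2, q.2))) :=
      V.continuous.comp (by fun_prop)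
    have h2 := hg.comp h1
    have h3 : Continuous (fun q : (X × X) × A => |u (q.1.1, q.2) - u (q.1.2, q.2)|) := by
      fun_prop
    exact h3.add h2
  let T : BoundedContinuousFunction (X × X) ℝ → BoundedContinuousFunction (X × X) ℝ := fun V =>
    BoundedContinuousFunction.ofNormedAddCommGroup (fun p => sSup (F V p '' K)) (hcont V)
      (C + γ ‖V‖) (hSb V)
  have hTa : ∀ V p, T V p = sSup (F V p '' K) := fun V p => rfl
  have hFd : ∀ V W p a, F V p a ≤ F W p a + γ' (dist V W) := by
    intro V W p a
    set q := (f (p.1, a), f (p.2, a)) with hq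
    have h1 := hγ'γ (max (V q) 0) (max (W q) 0) (le_max_right _ _) (le_max_right _ _)
    have h2 : |max (V q) 0 - max (W q) 0| ≤ dist V W :=
      (abs_max_sub_max_le_abs _ _ _).trans (V.dist_coe_le_dist (g := W) q)
    have h3 := hm (Set.mem_Ici.2 (abs_nonneg _)) (Set.mem_Ici.2 dist_nonneg) h2
    have h4 := le_abs_self (γ (max (V q) 0) - γ (max (W q) 0))
    simp only [F, ← hq]
    linarith
  obtain ⟨V, hV⟩ := aux_fix T hm hnn hit (by
    intro V W
    rw [BoundedContinuousFunction.dist_le (hnn _ dist_nonneg)]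
    intro p
    rw [hTa, hTa, Real.dist_eq, abs_sub_le_iff]
    constructor
    · linarith [aux_sup hne (hbdd W p) (fun a _ => hFd V W p a)]
    · have := aux_sup hne (hbdd V p) (fun a _ => hFd W V p a)
      rw [dist_comm] at this
      linarith)
  have hVa : ∀ p, V p = sSup (F V p '' K) := fun p => by
    rw [← hTa, hV]
  have hV0 : ∀ p, 0 ≤ V p := fun p => by rw [hVa]; exact hS0 V p
  refine ⟨V, V.continuous, ⟨‖V‖, V.norm_coe_le_norm⟩, hV0, fun x y => ?_⟩
  rw [hVa]
  simp only [F, max_eq_left (hV0 _)]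


/-- Assume the modulus of contraction `γ` of `δ` is itself a variable
discount function and `Ψ(x) = Ψ(y)` for all `x, y`.  Let `V̂*` be the unique bounded
continuous fixed point of the joint Bellman operator
`B̂(V)(x,y) = sup_{a ∈ Ψ(x)} [ |u(x,a) − u(y,a)| + γ(V(f(x,a), f(y,a))) ]`.  Then
(a) `V̂*(x,y) ≥ 0` for all `x, y` and `V̂*(x,x) = 0`;
(b) `V̂*(x,y) = V̂*(y,x)`:  `V̂*` is a symmetric nonnegative function vanishing on the
diagonal. -/
theorem joint_value_symmetric_nonneg
    {X A : Type*} [MetricSpace X] [CompleteSpace X] [MetricSpace A]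
    (Ψ : X → Set A) (f : X × A → X) (u : X × A → ℝ) (δ γ γ' : ℝ → ℝ)
    (hΨc : ∀ x, IsCompact (Ψ x)) (hΨne : ∀ x, (Ψ x).Nonempty)
    (hΨconst : ∀ x y, Ψ x = Ψ y)
    (hf : Continuous f) (hu : Continuous u)
    (hunn : ∀ p, 0 ≤ u p) (hub : ∃ C, ∀ p, u p ≤ C)
    -- `δ` is a variable discount function with `δ 0 = 0` and modulus of contraction `γ`:
    (hδcont : ContinuousOn δ (Set.Ici 0)) (hδmono : MonotoneOn δ (Set.Ici 0))
    (hδnn : ∀ t, 0 ≤ t → 0 ≤ δ t) (hδ0 : δ 0 = 0)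
    (hγmono : MonotoneOn γ (Set.Ici 0)) (hγnn : ∀ t, 0 ≤ t → 0 ≤ γ t)
    (hγiter : ∀ t, 0 ≤ t → Tendsto (fun n => γ^[n] t) atTop (𝓝 0))
    (hγδ : ∀ s t, 0 ≤ s → 0 ≤ t → |δ s - δ t| ≤ γ |s - t|)
    -- `γ` is itself a variable discount function, with modulus of contraction `γ'`:
    (hγcont : ContinuousOn γ (Set.Ici 0)) (hγ0 : γ 0 = 0)
    (hγ'mono : MonotoneOn γ' (Set.Ici 0)) (hγ'nn : ∀ t, 0 ≤ t → 0 ≤ γ' t)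
    (hγ'iter : ∀ t, 0 ≤ t → Tendsto (fun n => γ'^[n] t) atTop (𝓝 0))
    (hγ'γ : ∀ s t, 0 ≤ s → 0 ≤ t → |γ s - γ t| ≤ γ' |s - t|)
    -- `V̂*`, the unique bounded continuous fixed point of the joint Bellman operator:
    (V : X × X → ℝ) (hVc : Continuous V) (hVb : ∃ C, ∀ p, |V p| ≤ C)
    (hVfix : ∀ x y, V (x, y) =
      sSup ((fun a => |u (x, a) - u (y, a)| + γ (V (f (x, a), f (y, a)))) '' Ψ x))
    (hVuniq : ∀ V' : X × X → ℝ, Continuous V' → (∃ C, ∀ p, |V' p| ≤ C) →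
      (∀ x y, V' (x, y) =
        sSup ((fun a => |u (x, a) - u (y, a)| + γ (V' (f (x, a), f (y, a)))) '' Ψ x)) →
      V' = V) :
    (∀ x y, 0 ≤ V (x, y)) ∧ (∀ x, V (x, x) = 0) ∧ (∀ x y, V (x, y) = V (y, x)) := by
  have hV0 : ∀ x y, 0 ≤ V (x, y) := by
    intro x y
    obtain ⟨W, hW1, hW2, hW3, hW4⟩ := aux_exists (Ψ x) f u γ γ' (hΨc x) (hΨne x) hf hu hunn hub
      hγmono hγnn hγcont hγ'mono hγ'nn hγ'iter hγ'γ
    have := hVuniq W hW1 hW2 (fun a b => by rw [hΨconst a x]; exact hW4 a b)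
    rw [← this]
    exact hW3 _
  refine ⟨hV0, ?_, ?_⟩
  · obtain ⟨C, hC⟩ := hVb
    intro x0
    have hC0 : 0 ≤ C := (abs_nonneg _).trans (hC (x0, x0))
    have hit0 : ∀ n, 0 ≤ γ^[n] C := by
      intro n
      induction n with
      | zero => simpa
      | succ n ih => rw [Function.iterate_succ_apply']; exact hγnn _ ih
    have key : ∀ n x, V (x, x) ≤ γ^[n] C := by
      intro n
      induction n with
      | zero => intro x; exact (le_abs_self _).trans (hC _)
      | succ n ih =>
        intro x
        rw [hVfix, Function.iterate_succ_apply']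
        apply csSup_le ((hΨne x).image _)
        rintro _ ⟨a, _, rfl⟩
        simp only [sub_self, abs_zero, zero_add]
        exact hγmono (hV0 _ _) (hit0 n) (ih _)
    exact le_antisymm (ge_of_tendsto' (hγiter C hC0) (fun n => key n x0)) (hV0 _ _)
  · intro x y
    obtain ⟨C, hC⟩ := hVb
    have := hVuniq (fun p => V (p.2, p.1)) (hVc.comp (by fun_prop)) ⟨C, fun p => hC _⟩ (by
      intro a b
      show V (b, a) = _
      rw [hVfix b a, hΨconst b a]
      simp only [abs_sub_comm])
    exact (congrFun this (y, x))
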